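/- arXiv:2411.12860 — 10 statements merged into one kernel-verified Lean document; each statement's English description precedes it below -/
import Mathlib

section
/- There exists a one-sided matching market (one with four children and four homes), together with strict preferences (≻_c) and strict evaluations (>_c), in which no matching is both unanimous and ≻-efficient. -/
open scoped Classical

noncomputable section

variable {C H : Type*}

/-- Relations on `Option α`: rankings over homes together with `∅` (= `none`). -/
abbrev OptRel (α : Type*) := Option α → Option α → Prop

/-- `μ` is a (partial, one-to-one) matching: no home is assigned to two distinct children. -/
def IsMatching (μ : C → Option H) : Prop :=
  ∀ c c' h, μ c = some h → μ c' = some h → c = c'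

/-- `h` is unanimously acceptable for `c`: `h ≻_c ∅` and `h >_c ∅`. -/
def UnanAcc (pref eval : C → OptRel H) (c : C) (h : H) : Prop :=
  pref c (some h) none ∧ eval c (some h) none

/-- The unanimous improvers of `c` over `x`: homes preferred to `x` in both rankings. -/
def Improvers (pref eval : C → OptRel H) (c : C) (x : Option H) : Set H :=
  {h' | pref c (some h') x ∧ eval c (some h') x}

/-- `H*(c)`: unanimously acceptable homes with no unanimous improvement. -/
def Hstar (pref eval : C → OptRel H) (c : C) : Set H :=
  {h | UnanAcc pref eval c h ∧ Improvers pref eval c (some h) = ∅}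

/-- `H^-(c)`: unanimously acceptable homes not in `H*(c)`. -/
def Hminus (pref eval : C → OptRel H) (c : C) : Set H :=
  {h | UnanAcc pref eval c h ∧ h ∉ Hstar pref eval c}

/-- A matching is acceptable if every matched child gets a unanimously acceptable home. -/
def Acceptable (pref eval : C → OptRel H) (μ : C → Option H) : Prop :=
  ∀ c h, μ c = some h → UnanAcc pref eval c h

/-- `I*(μ)`: children matched to a home in `H*(c)`. -/
def Istar (pref eval : C → OptRel H) (μ : C → Option H) : Set C :=
  {c | ∃ h, μ c = some h ∧ h ∈ Hstar pref eval c}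

/-- `κ(μ)`: children matched to a unanimously acceptable home. -/
def kappaSet (pref eval : C → OptRel H) (μ : C → Option H) : Set C :=
  {c | ∃ h, μ c = some h ∧ (h ∈ Hstar pref eval c ∨ h ∈ Hminus pref eval c)}

/-- `μ ▷_UD μ'`: `μ` is unanimously dominated by `μ'`. -/
def UDom (pref eval : C → OptRel H) (μ μ' : C → Option H) : Prop :=
  (Istar pref eval μ ⊂ Istar pref eval μ' ∧ kappaSet pref eval μ ⊆ kappaSet pref eval μ') ∨
  (Istar pref eval μ ⊆ Istar pref eval μ' ∧ kappaSet pref eval μ ⊂ kappaSet pref eval μ')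

/-- An acceptable matching is unanimous if no acceptable matching unanimously dominates it. -/
def Unanimous (pref eval : C → OptRel H) (μ : C → Option H) : Prop :=
  IsMatching μ ∧ Acceptable pref eval μ ∧
    ∀ μ', IsMatching μ' → Acceptable pref eval μ' → ¬ UDom pref eval μ μ'

/-- `μ` is ≻-Pareto dominated by `μ'` (for strict rankings). -/
def ParetoDom (pref : C → OptRel H) (μ μ' : C → Option H) : Prop :=
  (∀ c, μ' c = μ c ∨ pref c (μ' c) (μ c)) ∧ ∃ c, pref c (μ' c) (μ c)

/-- `μ` is ≻-efficient: no matching ≻-Pareto dominates it. -/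
def EfficientM (pref : C → OptRel H) (μ : C → Option H) : Prop :=
  ¬ ∃ μ', IsMatching μ' ∧ ParetoDom pref μ μ'

/-- The level of `x` in the unanimous ranking `>_{I(c)}`: homes in `H*(c)` at level 3,
homes in `H^-(c)` at level 2, `∅` at level 1, all other homes at level 0.
`x >_{I(c)} y` iff `urank x > urank y`, and `x ∼_{I(c)} y` iff ranks are equal. -/
def urank (pref eval : C → OptRel H) (c : C) : Option H → ℕ
  | none => 1
  | some h =>
      if h ∈ Hstar pref eval c then 3 else if h ∈ Hminus pref eval c then 2 else 0

/-- The weak unanimous ranking: `x ≿_{I(c)} y`. -/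
def uweak (pref eval : C → OptRel H) (c : C) (x y : Option H) : Prop :=
  urank pref eval c y ≤ urank pref eval c x

/-- The strict part of a weak ranking `w`. -/
def SPref (w : OptRel H) (x y : Option H) : Prop := w x y ∧ ¬ w y x

/-- Individual rationality: every matched child strictly prefers her home to `∅`. -/
def IndivRat (w : C → OptRel H) (μ : C → Option H) : Prop :=
  ∀ c h, μ c = some h → SPref (w c) (some h) none

/-- One round of Serial Dictatorship with Indifference: dictator `c` refines the
current set to her strictly-acceptable best elements, unless that set is empty. -/
def sdiStep (w : C → OptRel H) (Ucur : Set (C → Option H)) (c : C) : Set (C → Option H) :=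
  let best := {μ ∈ Ucur | SPref (w c) (μ c) none ∧ ∀ μ' ∈ Ucur, w c (μ c) (μ' c)}
  if best = ∅ then Ucur else best

/-- The initial set for SDI: individually rational matchings. -/
def sdiInit (w : C → OptRel H) : Set (C → Option H) :=
  {μ | IsMatching μ ∧ IndivRat w μ}

/-- The final set of SDI given the dictator order `order`; SDI outputs any element of it. -/
def sdiFinal (w : C → OptRel H) (order : List C) : Set (C → Option H) :=
  order.foldl (sdiStep w) (sdiInit w)

/-- `μ` is improvable: some matching weakly shrinks every child's set of unanimous
improvers and matches some child to one of her current unanimous improvers. -/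
def Improvable (pref eval : C → OptRel H) (μ : C → Option H) : Prop :=
  ∃ μ', IsMatching μ' ∧
    (∀ c, Improvers pref eval c (μ' c) ⊆ Improvers pref eval c (μ c)) ∧
    ∃ c h, μ' c = some h ∧ h ∈ Improvers pref eval c (μ c)

/-- The extended unanimity relation `T^u_c`. -/
def Tu (pref eval : C → OptRel H) (c : C) : Option H → Option H → Prop
  | some h, some h' =>
      (h ∈ Hstar pref eval c ∧ h' ∉ Hstar pref eval c) ∨
      (h ∈ Hminus pref eval c ∧ h' ∉ Hstar pref eval c ∪ Hminus pref eval c) ∨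
      (((h ∈ Hstar pref eval c ∧ h' ∈ Hstar pref eval c) ∨
        (h ∈ Hminus pref eval c ∧ h' ∈ Hminus pref eval c) ∨
        (h ∉ Hstar pref eval c ∪ Hminus pref eval c ∧
         h' ∉ Hstar pref eval c ∪ Hminus pref eval c)) ∧
        pref c (some h) (some h'))
  | some h, none => UnanAcc pref eval c h
  | none, some h => ¬ UnanAcc pref eval c h
  | none, none => False

/-- The outcome Random Serial Assignment (ignoring feasibility constraints) gives a child
reporting `r`, under availability function `a`: her `r`-best available acceptable home,
or `∅` if there is none. -/
def IsRSAOutcome (a : H → Bool) (r : OptRel H) (x : Option H) : Prop :=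
  (x = none ∧ ∀ h, a h = true → ¬ r (some h) none) ∨
  (∃ h, x = some h ∧ a h = true ∧ r (some h) none ∧
    ∀ h', a h' = true → r (some h') none → h' = h ∨ r (some h) (some h'))

/-- `x` is a `p`-worst element of `S`. -/
def IsWorst (p : OptRel H) (S : Set (Option H)) (x : Option H) : Prop :=
  x ∈ S ∧ ∀ y ∈ S, y = x ∨ p y x

/-- `x` is a `p`-best element of `S`. -/
def IsBest (p : OptRel H) (S : Set (Option H)) (x : Option H) : Prop :=
  x ∈ S ∧ ∀ y ∈ S, y = x ∨ p x y


/-- The ranking of `Option α` induced by a utility index, smaller values being better. -/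
def rankRel {α : Type*} (r : Option α → ℕ) : OptRel α := fun x y => r x < r y

theorem isStrictTotalOrder_rankRel {α : Type*} {r : Option α → ℕ} (hr : Function.Injective r) :
    IsStrictTotalOrder (Option α) (rankRel r) :=
  (RelEmbedding.preimage ⟨r, hr⟩ (· < · : ℕ → ℕ → Prop)).isStrictTotalOrder

/-- Child `c` ranks home `c + 1` first, home `c` second, and `∅` third. -/
def cyclicRank (c : Fin 4) : Option (Fin 4) → ℕ
  | none => 2
  | some h => if h = c + 1 then 0 else if h = c then 1 else 3 + h

/-- Child `c` ranks home `c` first and `∅` second. -/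
def ownRank (c : Fin 4) : Option (Fin 4) → ℕ
  | none => 1
  | some h => if h = c then 0 else 2 + h

theorem cyclicRank_injective (c : Fin 4) : Function.Injective (cyclicRank c) := by
  rintro (_ | x) (_ | y) h <;> simp only [cyclicRank] at h <;> grind

theorem ownRank_injective (c : Fin 4) : Function.Injective (ownRank c) := by
  rintro (_ | x) (_ | y) h <;> simp only [ownRank] at h <;> grind

theorem unanAcc_iff_eq_own (c h : Fin 4) :
    UnanAcc (fun c => rankRel (cyclicRank c)) (fun c => rankRel (ownRank c)) c h ↔ h = c := by
  simp only [UnanAcc, rankRel, cyclicRank, ownRank]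
  grind

theorem own_mem_Hstar (c : Fin 4) :
    c ∈ Hstar (fun c => rankRel (cyclicRank c)) (fun c => rankRel (ownRank c)) c := by
  refine ⟨(unanAcc_iff_eq_own c c).2 rfl, Set.eq_empty_iff_forall_notMem.2 fun h hh => ?_⟩
  simpa [rankRel, ownRank] using hh.2

/-- Giving every child her own home is the only unanimous matching. -/
theorem eq_some_of_unanimous {μ : Fin 4 → Option (Fin 4)}
    (hμ : Unanimous (fun c => rankRel (cyclicRank c)) (fun c => rankRel (ownRank c)) μ) :
    μ = some := by
  obtain ⟨-, hacc, hmax⟩ := hμ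
  have hI : Istar (fun c => rankRel (cyclicRank c)) (fun c => rankRel (ownRank c)) some =
      Set.univ := Set.eq_univ_of_forall fun c => ⟨c, rfl, own_mem_Hstar c⟩
  have hκ : kappaSet (fun c => rankRel (cyclicRank c)) (fun c => rankRel (ownRank c)) some =
      Set.univ := Set.eq_univ_of_forall fun c => ⟨c, rfl, Or.inl (own_mem_Hstar c)⟩
  have hnd := hmax some (fun c c' h hc hc' => Option.some_injective _ (hc.trans hc'.symm))
    fun c h hc => (unanAcc_iff_eq_own c h).2 (Option.some_injective _ hc).symm
  funext c
  by_contra hc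
  refine hnd (Or.inr ⟨hI ▸ Set.subset_univ _, hκ ▸ Set.ssubset_univ_iff.2 fun huniv => ?_⟩)
  obtain ⟨h, hh, -⟩ := huniv ▸ Set.mem_univ c
  exact hc (hh.trans (congrArg some ((unanAcc_iff_eq_own c h).1 (hacc c h hh))))

/-- **Proposition: an efficient and unanimous matching can fail to exist.**
There is a market with four children and four homes in which no matching is both
unanimous and ≻-efficient. -/
theorem efficient_unanimous_can_fail_to_exist :
    ∃ pref eval : Fin 4 → OptRel (Fin 4),
      (∀ c, IsStrictTotalOrder (Option (Fin 4)) (pref c)) ∧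
      (∀ c, IsStrictTotalOrder (Option (Fin 4)) (eval c)) ∧
      ¬ ∃ μ : Fin 4 → Option (Fin 4), Unanimous pref eval μ ∧ EfficientM pref μ := by
  refine ⟨fun c => rankRel (cyclicRank c), fun c => rankRel (ownRank c),
    fun c => isStrictTotalOrder_rankRel (cyclicRank_injective c),
    fun c => isStrictTotalOrder_rankRel (ownRank_injective c), ?_⟩
  rintro ⟨μ, hμ, heff⟩
  obtain rfl := eq_some_of_unanimous hμ
  have himp (c : Fin 4) : rankRel (cyclicRank c) (some (c + 1)) (some c) := by
    simp [rankRel, cyclicRank]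
  refine heff ⟨fun c => some (c + 1), fun c c' h hc hc' => ?_, fun c => Or.inr (himp c), 0, himp 0⟩
  exact add_right_cancel (Option.some_injective _ (hc.trans hc'.symm))

end
end

section
/- If an acceptable matching μ is unanimous, then μ is efficient with respect to the profile of unanimous rankings (>_{I(c)})_{c∈C}: no matching Pareto dominates μ under (>_{I(c)}). -/
open scoped Classical

noncomputable section

variable {C H : Type*}

theorem one_le_urank_some_iff (pref eval : C → OptRel H) (c : C) (h : H) :
    1 ≤ urank pref eval c (some h) ↔ UnanAcc pref eval c h := by
  by_cases hs : h ∈ Hstar pref eval c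
  · simpa [urank, hs] using hs.1
  · simp [urank, Hminus, hs, Nat.one_le_iff_ne_zero]

theorem acceptable_iff_one_le_urank (pref eval : C → OptRel H) (μ : C → Option H) :
    Acceptable pref eval μ ↔ ∀ c, 1 ≤ urank pref eval c (μ c) := by
  refine forall_congr' fun c => ?_
  cases hc : μ c with
  | none => simp [urank]
  | some h => simp [one_le_urank_some_iff]

theorem mem_Istar_iff_three_le_urank (pref eval : C → OptRel H) (μ : C → Option H) (c : C) :
    c ∈ Istar pref eval μ ↔ 3 ≤ urank pref eval c (μ c) := by
  cases hc : μ c with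
  | none => simp [Istar, urank, hc]
  | some h =>
    simp only [Istar, urank, hc, Set.mem_ofPred_eq, Option.some.injEq, exists_eq_left']
    split_ifs <;> simp_all

theorem mem_kappaSet_iff_two_le_urank (pref eval : C → OptRel H) (μ : C → Option H) (c : C) :
    c ∈ kappaSet pref eval μ ↔ 2 ≤ urank pref eval c (μ c) := by
  cases hc : μ c with
  | none => simp [kappaSet, urank, hc]
  | some h =>
    simp only [kappaSet, urank, hc, Set.mem_ofPred_eq, Option.some.injEq, exists_eq_left']
    split_ifs <;> simp_all

theorem urank_le_three (pref eval : C → OptRel H) (c : C) (x : Option H) :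
    urank pref eval c x ≤ 3 := by
  cases x with
  | none => simp [urank]
  | some h => simp only [urank]; split_ifs <;> simp

/-- **unanimous ⟹ efficient w.r.t. the unanimous rankings.**
If an acceptable matching `μ` is unanimous, then no matching Pareto dominates it
with respect to the profile of unanimous rankings `>_{I(c)}` (encoded by `urank`). -/
theorem unanimous_implies_urank_efficient {C H : Type*} (pref eval : C → OptRel H)
    (hpref : ∀ c, IsStrictTotalOrder (Option H) (pref c))
    (heval : ∀ c, IsStrictTotalOrder (Option H) (eval c))
    (μ : C → Option H) (hμ : Unanimous pref eval μ) :
    ¬ ∃ μ' : C → Option H, IsMatching μ' ∧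
        (∀ c, urank pref eval c (μ c) ≤ urank pref eval c (μ' c)) ∧
        (∃ c, urank pref eval c (μ c) < urank pref eval c (μ' c)) := by
  rintro ⟨μ', hmatch, hle, c, hlt⟩
  obtain ⟨-, hacc, hdom⟩ := hμ
  rw [acceptable_iff_one_le_urank] at hacc
  refine hdom μ' hmatch
    ((acceptable_iff_one_le_urank ..).2 fun d => (hacc d).trans (hle d)) ?_
  have hI : Istar pref eval μ ⊆ Istar pref eval μ' := fun d hd => by
    rw [mem_Istar_iff_three_le_urank] at hd ⊢
    exact hd.trans (hle d)
  have hκ : kappaSet pref eval μ ⊆ kappaSet pref eval μ' := fun d hd => by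
    rw [mem_kappaSet_iff_two_le_urank] at hd ⊢
    exact hd.trans (hle d)
  have hpos := hacc c
  by_cases h3 : 3 ≤ urank pref eval c (μ' c)
  · refine Or.inl ⟨(Set.ssubset_iff_of_subset hI).2 ⟨c, ?_, ?_⟩, hκ⟩ <;>
      rw [mem_Istar_iff_three_le_urank]
    · exact h3
    · have := urank_le_three pref eval c (μ' c)
      omega
  · refine Or.inr ⟨hI, (Set.ssubset_iff_of_subset hκ).2 ⟨c, ?_, ?_⟩⟩ <;>
      rw [mem_kappaSet_iff_two_le_urank] <;> omega

end
end

section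
/- If an acceptable matching μ is efficient with respect to the profile of unanimous rankings (>_{I(c)})_{c∈C} (no matching Pareto dominates μ under (>_{I(c)})), then μ is unanimous. -/
open scoped Classical

noncomputable section

variable {C H : Type*}

/-- Under an acceptable matching, a child's unanimous rank is determined by her membership
in `I*(μ)` and `κ(μ)`. -/
lemma Acceptable.urank_eq {pref eval : C → OptRel H} {μ : C → Option H}
    (hacc : Acceptable pref eval μ) (c : C) :
    urank pref eval c (μ c) =
      1 + (if c ∈ kappaSet pref eval μ then 1 else 0) +
        (if c ∈ Istar pref eval μ then 1 else 0) := by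
  cases hc : μ c with
  | none => simp [urank, kappaSet, Istar, hc]
  | some h =>
    have h_acc := hacc c h hc
    by_cases hs : h ∈ Hstar pref eval c
    · simp [urank, kappaSet, Istar, hc, hs]
    · have hm : h ∈ Hminus pref eval c := ⟨h_acc, hs⟩
      simp [urank, kappaSet, Istar, hc, hs, hm]

/-- **efficient w.r.t. the unanimous rankings ⟹ unanimous.**
If an acceptable matching `μ` is not Pareto dominated by any matching with respect to
the profile of unanimous rankings `>_{I(c)}` (encoded by `urank`), then `μ` is unanimous. -/
theorem urank_efficient_implies_unanimous {C H : Type*} (pref eval : C → OptRel H)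
    (hpref : ∀ c, IsStrictTotalOrder (Option H) (pref c))
    (heval : ∀ c, IsStrictTotalOrder (Option H) (eval c))
    (μ : C → Option H) (hmatch : IsMatching μ) (hacc : Acceptable pref eval μ)
    (heff : ¬ ∃ μ' : C → Option H, IsMatching μ' ∧
        (∀ c, urank pref eval c (μ c) ≤ urank pref eval c (μ' c)) ∧
        (∃ c, urank pref eval c (μ c) < urank pref eval c (μ' c))) :
    Unanimous pref eval μ := by
  refine ⟨hmatch, hacc, fun μ' hmatch' hacc' hdom => heff ⟨μ', hmatch', fun c => ?_, ?_⟩⟩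
  · have hI : c ∈ Istar pref eval μ → c ∈ Istar pref eval μ' :=
      fun hc => hdom.elim (fun h => h.1.1 hc) (fun h => h.1 hc)
    have hκ : c ∈ kappaSet pref eval μ → c ∈ kappaSet pref eval μ' :=
      fun hc => hdom.elim (fun h => h.2 hc) (fun h => h.2.1 hc)
    rw [hacc.urank_eq, hacc'.urank_eq]
    split_ifs <;> first | omega | tauto
  · rcases hdom with ⟨hI, hκ⟩ | ⟨hI, hκ⟩
    · obtain ⟨c, hc', hc⟩ := Set.exists_of_ssubset hI
      have hκc := @hκ c
      refine ⟨c, ?_⟩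
      rw [hacc.urank_eq, hacc'.urank_eq, if_pos hc', if_neg hc]
      split_ifs <;> first | omega | tauto
    · obtain ⟨c, hc', hc⟩ := Set.exists_of_ssubset hκ
      have hIc := @hI c
      refine ⟨c, ?_⟩
      rw [hacc.urank_eq, hacc'.urank_eq, if_pos hc', if_neg hc]
      split_ifs <;> first | omega | tauto

end
end

section
/- For any one-sided matching market with preferences (≻_c) and evaluations (>_c), every matching output by Serial Dictatorship with Indifference run with the unanimous rankings (>_{I(c)})_{c∈C} as the dictators' preorders is a unanimous matching. -/
open scoped Classical

noncomputable section

variable {C H : Type*}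

theorem unanAcc_of_one_lt_urank {pref eval : C → OptRel H} {c : C} {h : H}
    (hr : 1 < urank pref eval c (some h)) : UnanAcc pref eval c h := by
  by_contra hn
  simp [urank, Hstar, Hminus, hn] at hr

theorem one_lt_urank_of_unanAcc {pref eval : C → OptRel H} {c : C} {h : H}
    (ha : UnanAcc pref eval c h) : 1 < urank pref eval c (some h) := by
  by_cases hs : h ∈ Hstar pref eval c
  · simp [urank, hs]
  · simp [urank, hs, show h ∈ Hminus pref eval c from ⟨ha, hs⟩]

theorem sPref_uweak_none_iff {pref eval : C → OptRel H} {c : C} {x : Option H} :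
    SPref (uweak pref eval c) x none ↔ 1 < urank pref eval c x := by
  simp only [SPref, uweak, urank]
  omega

/-- Under the unanimous rankings, individual rationality is acceptability. -/
theorem indivRat_uweak_iff_acceptable {pref eval : C → OptRel H} {μ : C → Option H} :
    IndivRat (uweak pref eval) μ ↔ Acceptable pref eval μ := by
  simp only [IndivRat, Acceptable, sPref_uweak_none_iff]
  exact ⟨fun hμ c h hc => unanAcc_of_one_lt_urank (hμ c h hc),
    fun hμ c h hc => one_lt_urank_of_unanAcc (hμ c h hc)⟩

theorem Acceptable.one_le_urank {pref eval : C → OptRel H} {μ : C → Option H}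
    (hμ : Acceptable pref eval μ) (c : C) : 1 ≤ urank pref eval c (μ c) := by
  cases hc : μ c with
  | none => simp [urank]
  | some h => exact (one_lt_urank_of_unanAcc (hμ c h hc)).le

theorem mem_Istar_iff_urank {pref eval : C → OptRel H} {μ : C → Option H} {c : C} :
    c ∈ Istar pref eval μ ↔ urank pref eval c (μ c) = 3 := by
  cases hc : μ c with
  | none => simp [Istar, urank, hc]
  | some h =>
    simp only [Istar, urank, Set.mem_ofPred_eq, hc, Option.some.injEq, exists_eq_left']
    split_ifs <;> simp_all

theorem mem_kappaSet_iff_urank {pref eval : C → OptRel H} {μ : C → Option H} {c : C} :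
    c ∈ kappaSet pref eval μ ↔ 1 < urank pref eval c (μ c) := by
  cases hc : μ c with
  | none => simp [kappaSet, urank, hc]
  | some h =>
    simp only [kappaSet, urank, Set.mem_ofPred_eq, hc, Option.some.injEq, exists_eq_left']
    split_ifs <;> simp_all

theorem sdiStep_subset (w : C → OptRel H) (U : Set (C → Option H)) (c : C) :
    sdiStep w U c ⊆ U := by
  simp only [sdiStep]
  split_ifs
  · exact subset_rfl
  · exact Set.sep_subset _ _

theorem foldl_sdiStep_subset (w : C → OptRel H) (order : List C) (U : Set (C → Option H)) :
    order.foldl (sdiStep w) U ⊆ U := by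
  induction order generalizing U with
  | nil => exact subset_rfl
  | cons c l ih => exact (ih _).trans (sdiStep_subset w U c)

/-- A matching surviving the turn of a dictator has the highest rank for her in the current set. -/
theorem urank_le_of_mem_sdiStep {pref eval : C → OptRel H} {U : Set (C → Option H)} {c : C}
    (hU : ∀ ν ∈ U, Acceptable pref eval ν) {μ ν : C → Option H}
    (hμ : μ ∈ sdiStep (uweak pref eval) U c) (hν : ν ∈ U) :
    urank pref eval c (ν c) ≤ urank pref eval c (μ c) := by
  simp only [sdiStep] at hμ
  split_ifs at hμ with hempty
  · by_contra! hlt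
    have hfin : (U.image fun ρ => urank pref eval c (ρ c)).Finite :=
      (Set.finite_Iic 3).subset (by rintro _ ⟨ρ, -, rfl⟩; exact urank_le_three _ _ _ _)
    obtain ⟨_, ⟨ρ, hρ, rfl⟩, hmax⟩ := Set.exists_max_image _ id hfin ⟨_, ν, hν, rfl⟩
    replace hmax : ∀ σ ∈ U, urank pref eval c (σ c) ≤ urank pref eval c (ρ c) :=
      fun σ hσ => hmax _ ⟨σ, hσ, rfl⟩
    have hone := (hU μ hμ).one_le_urank c
    have hle := hmax ν hν
    exact Set.eq_empty_iff_forall_notMem.mp hempty ρ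
      ⟨hρ, sPref_uweak_none_iff.mpr (by omega), hmax⟩
  · exact hμ.2.2 ν hν

/-- A matching ranked by the dictator as high as a survivor of her round survives as well. -/
theorem mem_sdiStep_of_urank_eq {pref eval : C → OptRel H} {U : Set (C → Option H)} {c : C}
    {μ ν : C → Option H} (hμ : μ ∈ sdiStep (uweak pref eval) U c) (hν : ν ∈ U)
    (heq : urank pref eval c (ν c) = urank pref eval c (μ c)) :
    ν ∈ sdiStep (uweak pref eval) U c := by
  simp only [sdiStep] at hμ ⊢
  split_ifs at hμ ⊢
  · exact hν
  · refine ⟨hν, ?_⟩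
    simpa only [sPref_uweak_none_iff, uweak, heq] using hμ.2

/-- No member of the current set weakly improves on an output with a strict improvement for
some remaining dictator. -/
theorem urank_eq_of_mem_foldl_sdiStep {pref eval : C → OptRel H} {order : List C}
    {U : Set (C → Option H)} (hU : ∀ ν ∈ U, Acceptable pref eval ν) {μ ν : C → Option H}
    (hμ : μ ∈ order.foldl (sdiStep (uweak pref eval)) U) (hν : ν ∈ U)
    (hle : ∀ c, urank pref eval c (μ c) ≤ urank pref eval c (ν c)) :
    ∀ c ∈ order, urank pref eval c (ν c) = urank pref eval c (μ c) := by
  induction order generalizing U with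
  | nil => simp
  | cons d l ih =>
    have hstep : μ ∈ sdiStep (uweak pref eval) U d := foldl_sdiStep_subset _ _ _ hμ
    have heq := (urank_le_of_mem_sdiStep hU hstep hν).antisymm (hle d)
    have hrest := ih (fun ρ hρ => hU ρ (sdiStep_subset _ _ _ hρ)) hμ
      (mem_sdiStep_of_urank_eq hstep hν heq)
    intro c hc
    rcases List.mem_cons.mp hc with rfl | hc
    · exact heq
    · exact hrest c hc

/-- **SDI with unanimous rankings is a unanimous mechanism.**
Every matching output by Serial Dictatorship with Indifference run with the unanimous
rankings `>_{I(c)}` (weak relation `uweak`) as the dictators' preorders is unanimous. -/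
theorem sdi_output_unanimous {C H : Type*} (pref eval : C → OptRel H)
    (hpref : ∀ c, IsStrictTotalOrder (Option H) (pref c))
    (heval : ∀ c, IsStrictTotalOrder (Option H) (eval c))
    (order : List C) (horder : ∀ c, c ∈ order)
    (μ : C → Option H) (hμ : μ ∈ sdiFinal (uweak pref eval) order) :
    Unanimous pref eval μ := by
  have hinit : μ ∈ sdiInit (uweak pref eval) := foldl_sdiStep_subset _ _ _ hμ
  have hacc : Acceptable pref eval μ := indivRat_uweak_iff_acceptable.mp hinit.2
  refine ⟨hinit.1, hacc, fun ν hν hνacc hdom => ?_⟩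
  have hsub : Istar pref eval μ ⊆ Istar pref eval ν ∧
      kappaSet pref eval μ ⊆ kappaSet pref eval ν :=
    hdom.elim (fun h => ⟨h.1.subset, h.2⟩) (fun h => ⟨h.1, h.2.subset⟩)
  have hle : ∀ c, urank pref eval c (μ c) ≤ urank pref eval c (ν c) := by
    intro c
    have hI := @hsub.1 c
    have hκ := @hsub.2 c
    rw [mem_Istar_iff_urank, mem_Istar_iff_urank] at hI
    rw [mem_kappaSet_iff_urank, mem_kappaSet_iff_urank] at hκ
    have := urank_le_three pref eval c (μ c)
    have := hνacc.one_le_urank c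
    omega
  have heq : ∀ c, urank pref eval c (ν c) = urank pref eval c (μ c) := fun c =>
    urank_eq_of_mem_foldl_sdiStep (fun ρ hρ => indivRat_uweak_iff_acceptable.mp hρ.2) hμ
      ⟨hν, indivRat_uweak_iff_acceptable.mpr hνacc⟩ hle c (horder c)
  rcases hdom with ⟨h, -⟩ | ⟨-, h⟩
  · exact h.2 fun c hc => mem_Istar_iff_urank.mpr (heq c ▸ mem_Istar_iff_urank.mp hc)
  · exact h.2 fun c hc => mem_kappaSet_iff_urank.mpr (heq c ▸ mem_kappaSet_iff_urank.mp hc)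

end
end

section
/- There exists a one-sided matching market with preferences (≻_c) and evaluations (>_c) (one with three children and three homes) together with a matching μ such that μ is unanimous but μ is not ≻-efficient. -/
open scoped Classical

noncomputable section

variable {C H : Type*}

/-- The strict ranking of `Option H` by the values `v`, with `∅` last. -/
def rankBy (v : H → ℕ) : OptRel H :=
  fun x y => y.elim 0 (fun h => v h + 1) < x.elim 0 (fun h => v h + 1)

theorem isStrictTotalOrder_rankBy {v : H → ℕ} (hv : Function.Injective v) :
    IsStrictTotalOrder (Option H) (rankBy v) where
  irrefl _ := lt_irrefl _
  trans _ _ _ hxy hyz := lt_trans hyz hxy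
  trichotomous x y hxy hyx := by
    have h := le_antisymm (not_lt.1 hxy) (not_lt.1 hyx)
    cases x <;> cases y <;> simp_all [hv.eq_iff]

/-- Homes ranked by opposite orders are all in `H*`. -/
theorem mem_Hstar_rankBy {v w : C → H → ℕ} {c : C}
    (hvw : ∀ h h', v c h < v c h' → w c h' ≤ w c h) (h : H) :
    h ∈ Hstar (fun c => rankBy (v c)) (fun c => rankBy (w c)) c := by
  refine ⟨⟨Nat.succ_pos _, Nat.succ_pos _⟩, Set.eq_empty_of_forall_notMem ?_⟩
  rintro h' ⟨h₁, h₂⟩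
  exact (hvw h h' (Nat.lt_of_succ_lt_succ h₁)).not_gt (Nat.lt_of_succ_lt_succ h₂)

/-- A matching that gives every child a home in `H*` is unanimous. -/
theorem unanimous_of_forall_mem_Hstar {pref eval : C → OptRel H} {f : C → H}
    (hf : Function.Injective f) (hstar : ∀ c, f c ∈ Hstar pref eval c) :
    Unanimous pref eval (fun c => some (f c)) := by
  refine ⟨fun c c' h hc hc' => hf (Option.some.inj (hc.trans hc'.symm)), ?_, ?_⟩
  · rintro c h hc
    exact Option.some.inj hc ▸ (hstar c).1
  · rintro μ' - - (⟨h, -⟩ | ⟨-, h⟩)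
    · exact h.2 fun c _ => ⟨f c, rfl, hstar c⟩
    · exact h.2 fun c _ => ⟨f c, rfl, Or.inl (hstar c)⟩

/-- **Example: unanimous matchings can be inefficient.**
There is a market with three children and three homes and a matching that is
unanimous but not ≻-efficient. -/
theorem unanimous_not_efficient_example :
    ∃ pref eval : Fin 3 → OptRel (Fin 3),
      (∀ c, IsStrictTotalOrder (Option (Fin 3)) (pref c)) ∧
      (∀ c, IsStrictTotalOrder (Option (Fin 3)) (eval c)) ∧
      ∃ μ : Fin 3 → Option (Fin 3), Unanimous pref eval μ ∧ ¬ EfficientM pref μ := by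
  let σ : Fin 3 → Equiv.Perm (Fin 3) := fun c => if c = 1 then Equiv.swap 0 1 else 1
  refine ⟨fun c => rankBy fun h => (σ c h : ℕ), fun c => rankBy fun h => ((σ c h).rev : ℕ),
    fun c => isStrictTotalOrder_rankBy (Fin.val_injective.comp (σ c).injective),
    fun c => isStrictTotalOrder_rankBy
      (Fin.val_injective.comp (Fin.rev_injective.comp (σ c).injective)),
    fun c => some c,
    unanimous_of_forall_mem_Hstar Function.injective_id fun c => mem_Hstar_rankBy
      (fun h h' hlt => Fin.rev_le_rev.2 hlt.le) c,
    not_not.2 ⟨fun c => some (Equiv.swap 0 1 c),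
      fun c c' h hc hc' => (Equiv.swap 0 1).injective (Option.some.inj (hc.trans hc'.symm)),
      fun c => ?_, 0, ?_⟩⟩
  · fin_cases c
    · exact Or.inr (by simp [rankBy, σ])
    · exact Or.inr (by simp [rankBy, σ])
    · exact Or.inl (by decide)
  · simp [rankBy, σ]

end
end

section
/- There exists a one-sided matching market with preferences (≻_c) and evaluations (>_c) together with an acceptable matching μ such that μ is unimprovable but μ is not unanimous. -/
open scoped Classical

noncomputable section

variable {C H : Type*}

/-- The ranking in which `x` is above `y` when `x` has the smaller position. -/
def posRel {α : Type*} (r : Option α → ℕ) : OptRel α := fun x y => r x < r y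

theorem posRel_isStrictTotalOrder {α : Type*} {r : Option α → ℕ} (hr : Function.Injective r) :
    IsStrictTotalOrder (Option α) (posRel r) where
  trichotomous _ _ hxy hyx := hr (le_antisymm (not_lt.1 hyx) (not_lt.1 hxy))
  irrefl _ := lt_irrefl _
  trans _ _ _ := lt_trans

/-- Positions in the preferences of the example market. -/
def prefPos (c : Fin 4) : Option (Fin 4) → ℕ
  | none => ![4, 1, 1, 1] c
  | some h => ![![0, 2, 1, 3], ![2, 3, 0, 4], ![0, 2, 3, 4], ![2, 0, 3, 4]] c h

/-- Positions in the evaluations of the example market, which differ from the preferences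
only for child `0`. -/
def evalPos (c : Fin 4) : Option (Fin 4) → ℕ
  | none => ![4, 1, 1, 1] c
  | some h => ![![2, 0, 3, 1], ![2, 3, 0, 4], ![0, 2, 3, 4], ![2, 0, 3, 4]] c h

theorem mem_kappaSet_iff {pref eval : C → OptRel H} {μ : C → Option H} {c : C} :
    c ∈ kappaSet pref eval μ ↔ ∃ h, μ c = some h ∧ UnanAcc pref eval c h := by
  simp only [kappaSet, Hminus, Set.mem_ofPred_eq]
  refine exists_congr fun h => and_congr_right fun _ => ⟨?_, fun hh => ?_⟩
  · rintro (hh | hh) <;> exact hh.1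
  · by_cases hs : h ∈ Hstar pref eval c
    exacts [Or.inl hs, Or.inr ⟨hh, hs⟩]

/-- The unimprovable matching of the example market. -/
def unimprovableMatching : Fin 4 → Option (Fin 4) := ![some 2, none, some 0, some 1]

/-- A matching of the example market that unanimously dominates `unimprovableMatching`. -/
def dominatingMatching : Fin 4 → Option (Fin 4) := ![some 3, some 2, some 0, some 1]

theorem not_improvable_unimprovableMatching :
    ¬ Improvable (fun c => posRel (prefPos c)) (fun c => posRel (evalPos c))
      unimprovableMatching := by
  rintro ⟨μ', hm, hsub, c, h, hc, himp⟩
  have key : ∀ (c : Fin 4) (x : Option (Fin 4)),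
      (∀ h, prefPos c (some h) < prefPos c x ∧ evalPos c (some h) < evalPos c x →
        prefPos c (some h) < prefPos c (unimprovableMatching c) ∧
        evalPos c (some h) < evalPos c (unimprovableMatching c)) →
      c = 1 ∨ x = unimprovableMatching c ∨ c = 0 ∧ (x = some 0 ∨ x = some 1) := by decide
  have hkeep c := key c (μ' c) fun h => @hsub c h
  have h2 : μ' 2 = some 0 := by simpa [unimprovableMatching] using hkeep 2
  have h3 : μ' 3 = some 1 := by simpa [unimprovableMatching] using hkeep 3
  have h0 : μ' 0 = some 2 := by
    rcases hkeep 0 with h | h | ⟨-, h | h⟩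
    · exact absurd h (by decide)
    · exact h
    · exact absurd (hm _ _ _ h h2) (by decide)
    · exact absurd (hm _ _ _ h h3) (by decide)
  have himprovers : ∀ c h : Fin 4,
      prefPos c (some h) < prefPos c (unimprovableMatching c) ∧
        evalPos c (some h) < evalPos c (unimprovableMatching c) →
      c = 0 ∧ h = 0 ∨ c = 1 ∧ h = 2 := by decide
  rcases himprovers c h himp with ⟨rfl, rfl⟩ | ⟨rfl, rfl⟩
  · exact absurd (hm _ _ _ hc h2) (by decide)
  · exact absurd (hm _ _ _ hc h0) (by decide)

theorem uDom_dominatingMatching :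
    UDom (fun c => posRel (prefPos c)) (fun c => posRel (evalPos c))
      unimprovableMatching dominatingMatching := by
  refine Or.inr ⟨?_, Set.ssubset_iff_of_subset ?_ |>.2 ⟨1, ?_, ?_⟩⟩
  · rintro c ⟨h, hc, hh, hemp⟩
    refine ⟨h, ?_, hh, hemp⟩
    have hstay : ∀ c h, unimprovableMatching c = some h →
        dominatingMatching c = some h ∨ c = 0 ∧ h = 2 := by decide
    rcases hstay c h hc with hd | ⟨rfl, rfl⟩
    · exact hd
    · have : (0 : Fin 4) ∈ Improvers (fun c => posRel (prefPos c))
          (fun c => posRel (evalPos c)) 0 (some 2) :=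
        (by decide : prefPos 0 (some 0) < prefPos 0 (some 2) ∧
          evalPos 0 (some 0) < evalPos 0 (some 2))
      exact absurd this (by simp [hemp])
  · have hmatched : ∀ c, ∃ h, dominatingMatching c = some h ∧
        prefPos c (some h) < prefPos c none ∧ evalPos c (some h) < evalPos c none := by decide
    exact fun c _ => mem_kappaSet_iff.2 (hmatched c)
  · exact mem_kappaSet_iff.2 ⟨2, rfl,
      (by decide : prefPos 1 (some 2) < prefPos 1 none ∧ evalPos 1 (some 2) < evalPos 1 none)⟩
  · rintro ⟨h, hc, -⟩
    exact absurd hc (by revert h; decide)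

/-- **unimprovable matchings can fail to be unanimous.**
There is a market together with an acceptable matching that is unimprovable
but not unanimous. -/
theorem unimprovable_not_unanimous_example :
    ∃ pref eval : Fin 4 → OptRel (Fin 4),
      (∀ c, IsStrictTotalOrder (Option (Fin 4)) (pref c)) ∧
      (∀ c, IsStrictTotalOrder (Option (Fin 4)) (eval c)) ∧
      ∃ μ : Fin 4 → Option (Fin 4), IsMatching μ ∧ Acceptable pref eval μ ∧
        ¬ Improvable pref eval μ ∧ ¬ Unanimous pref eval μ := by
  have hacc : ∀ c h, unimprovableMatching c = some h →
      prefPos c (some h) < prefPos c none ∧ evalPos c (some h) < evalPos c none := by decide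
  have hacc' : ∀ c h, dominatingMatching c = some h →
      prefPos c (some h) < prefPos c none ∧ evalPos c (some h) < evalPos c none := by decide
  refine ⟨fun c => posRel (prefPos c), fun c => posRel (evalPos c),
    fun c => posRel_isStrictTotalOrder ?_, fun c => posRel_isStrictTotalOrder ?_,
    unimprovableMatching, ?_, hacc, not_improvable_unimprovableMatching, fun hun => ?_⟩
  · unfold Function.Injective
    revert c
    decide
  · unfold Function.Injective
    revert c
    decide
  · unfold IsMatching
    decide
  · refine hun.2.2 dominatingMatching ?_ hacc' uDom_dominatingMatching
    unfold IsMatching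
    decide

end
end

section
/- A unanimous and strategy-proof mechanism does not exist: there is a one-sided matching market (one with two children and three homes) and a fixed profile of evaluations (>_c) such that no mechanism φ, mapping each profile of strict preferences (≻_c) to a matching that is unanimous with respect to ((≻_c),(>_c)), is strategy-proof; that is, for every such φ there exist a child c, a true preference profile, and a misreport ≻'_c such that c's assignment under the misreported profile is strictly ≻_c-preferred to her assignment under the true profile. -/
open scoped Classical

noncomputable section

variable {C H : Type*}

/-- The ranking that orders alternatives by increasing position. -/
def rankingOf (r : Option H → ℕ) : OptRel H := fun x y => r x < r y

theorem isStrictTotalOrder_rankingOf {r : Option H → ℕ} (hr : Function.Injective r) :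
    IsStrictTotalOrder (Option H) (rankingOf r) :=
  (RelEmbedding.preimage ⟨r, hr⟩ (· < ·)).isStrictTotalOrder

/-- The position function placing homes `0`, `1`, `2` and `∅` at `a`, `b`, `c` and `n`. -/
def positions (a b c n : ℕ) : Option (Fin 3) → ℕ
  | none => n
  | some 0 => a
  | some 1 => b
  | some 2 => c

theorem kappaSet_eq_univ_of_Istar_eq_univ {pref eval : C → OptRel H} {μ : C → Option H}
    (h : Istar pref eval μ = Set.univ) : kappaSet pref eval μ = Set.univ := by
  refine Set.eq_univ_of_forall fun c => ?_
  obtain ⟨x, hx, hs⟩ : c ∈ Istar pref eval μ := h ▸ Set.mem_univ c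
  exact ⟨x, hx, Or.inl hs⟩

/-- If some matching gives every child a home in `H*`, so does every unanimous matching. -/
theorem Unanimous.Istar_eq_univ {pref eval : C → OptRel H} {μ ν : C → Option H}
    (hμ : Unanimous pref eval μ) (hν : IsMatching ν) (hs : Istar pref eval ν = Set.univ) :
    Istar pref eval μ = Set.univ := by
  by_contra hne
  refine hμ.2.2 ν hν (fun c h hc => ?_) (Or.inl ⟨?_, ?_⟩)
  · obtain ⟨x, hx, hsx⟩ : c ∈ Istar pref eval ν := hs ▸ Set.mem_univ c
    obtain rfl : x = h := Option.some.inj (hx.symm.trans hc)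
    exact hsx.1
  · rw [hs]
    exact Set.ssubset_univ_iff.mpr hne
  · rw [kappaSet_eq_univ_of_Istar_eq_univ hs]
    exact Set.subset_univ _

/-- Suppose child `0` has `2` as her only home in `H*`, and child `1` has exactly `2` and
`h ≠ 2` in `H*`. Then every unanimous matching assigns `h` to child `1`. -/
theorem Unanimous.apply_one_eq {pref eval : Fin 2 → OptRel (Fin 3)} {μ : Fin 2 → Option (Fin 3)}
    (hμ : Unanimous pref eval μ) {h : Fin 3} (hne : h ≠ 2)
    (h₀ : Hstar pref eval 0 = {2}) (h₁ : Hstar pref eval 1 = {2, h}) : μ 1 = some h := by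
  have hall : Istar pref eval μ = Set.univ := by
    refine hμ.Istar_eq_univ (ν := ![some 2, some h]) ?_ (Set.eq_univ_of_forall fun c => ?_)
    · intro c c' x hc hc'
      fin_cases c <;> fin_cases c' <;> simp_all
    · fin_cases c
      · exact ⟨2, rfl, by simp [h₀]⟩
      · exact ⟨h, rfl, by simp [h₁]⟩
  obtain ⟨x, hx, hxs⟩ : (0 : Fin 2) ∈ Istar pref eval μ := hall ▸ Set.mem_univ _
  obtain ⟨y, hy, hys⟩ : (1 : Fin 2) ∈ Istar pref eval μ := hall ▸ Set.mem_univ _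
  rw [h₀, Set.mem_singleton_iff] at hxs
  rw [h₁] at hys
  rcases hys with rfl | rfl
  · exact absurd (hμ.1 0 1 2 (hxs ▸ hx) hy) (by decide)
  · exact hy

/-- **no unanimous and strategy-proof mechanism exists.**
There is a market with two children and three homes and a fixed profile of evaluations
such that every mechanism that always outputs a unanimous matching is manipulable:
some child, at some true preference profile, has a misreport giving her a strictly
better assignment. -/
theorem no_unanimous_strategyproof_mechanism :
    ∃ eval : Fin 2 → OptRel (Fin 3),
      (∀ c, IsStrictTotalOrder (Option (Fin 3)) (eval c)) ∧
      ∀ φ : (Fin 2 → OptRel (Fin 3)) → (Fin 2 → Option (Fin 3)),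
        (∀ pref : Fin 2 → OptRel (Fin 3),
          (∀ c, IsStrictTotalOrder (Option (Fin 3)) (pref c)) →
          Unanimous pref eval (φ pref)) →
        ∃ (pref : Fin 2 → OptRel (Fin 3)) (c : Fin 2) (q : OptRel (Fin 3)),
          (∀ c', IsStrictTotalOrder (Option (Fin 3)) (pref c')) ∧
          IsStrictTotalOrder (Option (Fin 3)) q ∧
          pref c (φ (Function.update pref c q) c) (φ pref c) := by
  let eval : Fin 2 → OptRel (Fin 3) :=
    ![rankingOf (positions 0 1 2 3), rankingOf (positions 0 2 1 3)]
  have inj {a b c n : ℕ} (h : [a, b, c, n].Nodup) :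
      Function.Injective (positions a b c n) := by
    rintro (_ | x) (_ | y) hxy <;> [rfl; fin_cases y; fin_cases x; (fin_cases x <;> fin_cases y)] <;>
      simp_all [positions]
  refine ⟨eval, ?_, fun φ hφ => ?_⟩
  · intro c
    fin_cases c <;> exact isStrictTotalOrder_rankingOf (inj (by decide))
  let p : OptRel (Fin 3) := rankingOf (positions 2 3 0 1)
  let t : OptRel (Fin 3) := rankingOf (positions 2 1 0 3)
  let q : OptRel (Fin 3) := rankingOf (positions 3 0 1 2)
  have hp : IsStrictTotalOrder _ p := isStrictTotalOrder_rankingOf (inj (by decide))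
  have ht : IsStrictTotalOrder _ t := isStrictTotalOrder_rankingOf (inj (by decide))
  have hq : IsStrictTotalOrder _ q := isStrictTotalOrder_rankingOf (inj (by decide))
  have hpt : ∀ c, IsStrictTotalOrder _ (![p, t] c) := by
    intro c; fin_cases c <;> assumption
  have hpq : ∀ c, IsStrictTotalOrder _ (![p, q] c) := by
    intro c; fin_cases c <;> assumption
  have hupd : Function.update ![p, t] 1 q = ![p, q] := by
    ext c; fin_cases c <;> rfl
  have truthful : φ ![p, t] 1 = some 0 := by
    refine (hφ _ hpt).apply_one_eq (by decide) ?_ ?_ <;> ext x <;> fin_cases x <;>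
      simp [Hstar, UnanAcc, Improvers, Set.eq_empty_iff_forall_notMem, Fin.forall_fin_succ,
        eval, p, t, rankingOf, positions]
  have misreport : φ ![p, q] 1 = some 1 := by
    refine (hφ _ hpq).apply_one_eq (by decide) ?_ ?_ <;> ext x <;> fin_cases x <;>
      simp [Hstar, UnanAcc, Improvers, Set.eq_empty_iff_forall_notMem, Fin.forall_fin_succ,
        eval, p, q, rankingOf, positions]
  refine ⟨![p, t], 1, q, hpt, hq, ?_⟩
  rw [hupd, truthful, misreport]
  show positions 2 1 0 3 (some 1) < positions 2 1 0 3 (some 0)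
  decide

end
end

section
/- There exists a one-sided matching market (one with two children and four homes) such that every mechanism mapping each profile ((≻_c),(>_c)) to a unanimous matching is obviously manipulable: some child with some true preference–evaluation pair has a worst-case manipulation. -/
open scoped Classical

noncomputable section

variable {C H : Type*}

/-- The set of assignments to child `c` consistent with her reported pair `(p, e)` under
the mechanism `φ`: outcomes of `φ` for some strict profile of the other children. -/
def ConsistentOut
    (φ : (Fin 2 → OptRel (Fin 4)) → (Fin 2 → OptRel (Fin 4)) → Fin 2 → Option (Fin 4))
    (c : Fin 2) (p e : OptRel (Fin 4)) : Set (Option (Fin 4)) :=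
  {x | ∃ pref eval : Fin 2 → OptRel (Fin 4),
        (∀ c', IsStrictTotalOrder (Option (Fin 4)) (pref c')) ∧
        (∀ c', IsStrictTotalOrder (Option (Fin 4)) (eval c')) ∧
        pref c = p ∧ eval c = e ∧ φ pref eval c = x}

/-- If some matching gives every child an unimprovable home, so does every unanimous matching. -/
theorem Unanimous.exists_mem_Hstar {pref eval : C → OptRel H} {μ : C → Option H}
    (hμ : Unanimous pref eval μ) {ν : C → H} (hν : Function.Injective ν)
    (hstar : ∀ c, ν c ∈ Hstar pref eval c) (c : C) :
    ∃ h, μ c = some h ∧ h ∈ Hstar pref eval c := by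
  by_contra hc
  have hI : Istar pref eval (fun c => some (ν c)) = Set.univ :=
    Set.eq_univ_of_forall fun c => ⟨ν c, rfl, hstar c⟩
  have hκ : kappaSet pref eval (fun c => some (ν c)) = Set.univ :=
    Set.eq_univ_of_forall fun c => ⟨ν c, rfl, Or.inl (hstar c)⟩
  refine hμ.2.2 (fun c => some (ν c)) ?_ ?_ (Or.inl ⟨?_, ?_⟩)
  · intro c c' h h₁ h₂
    exact hν (Option.some.inj (h₁.trans h₂.symm))
  · intro c h hh
    obtain rfl := Option.some.inj hh
    exact (hstar c).1
  · rw [hI, Set.ssubset_univ_iff]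
    intro h
    exact hc (h ▸ Set.mem_univ c : c ∈ Istar pref eval μ)
  · rw [hκ]
    exact Set.subset_univ _

/-- A child with a unanimously acceptable home has an unimprovable one. -/
theorem UnanAcc.exists_mem_Hstar [Finite H] {pref eval : C → OptRel H} {c : C} {h : H}
    (hp : IsStrictTotalOrder (Option H) (pref c)) (he : IsStrictTotalOrder (Option H) (eval c))
    (hh : UnanAcc pref eval c h) : ∃ h', h' ∈ Hstar pref eval c := by
  have wf : WellFounded fun x y : Option H => pref c x y :=
    Finite.wellFounded_of_trans_of_irrefl _
  obtain ⟨m, ⟨k, rfl, hk⟩, hmin⟩ :=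
    wf.has_min {x | ∃ k, x = some k ∧ UnanAcc pref eval c k} ⟨some h, h, rfl, hh⟩
  refine ⟨k, hk, Set.eq_empty_of_forall_notMem fun k' hk' => ?_⟩
  exact hmin (some k') ⟨k', rfl, _root_.trans hk'.1 hk.1, _root_.trans hk'.2 hk.2⟩ hk'.1

/-- With two children, a child with two unimprovable homes gets an unimprovable home in every
unanimous matching. -/
theorem Unanimous.mem_Hstar_of_two [Finite H] {pref eval : Fin 2 → OptRel H}
    {μ : Fin 2 → Option H} (hμ : Unanimous pref eval μ)
    (hp : ∀ c, IsStrictTotalOrder (Option H) (pref c))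
    (he : ∀ c, IsStrictTotalOrder (Option H) (eval c)) {a b : H} (hab : a ≠ b)
    (ha : a ∈ Hstar pref eval 0) (hb : b ∈ Hstar pref eval 0) :
    ∃ h, μ 0 = some h ∧ h ∈ Hstar pref eval 0 := by
  by_cases hacc : ∃ h, UnanAcc pref eval 1 h
  · obtain ⟨h, hh⟩ := hacc
    obtain ⟨k, hk⟩ := hh.exists_mem_Hstar (hp 1) (he 1)
    obtain ⟨x, hx, hxk⟩ : ∃ x ∈ Hstar pref eval 0, x ≠ k := by
      by_cases hak : a = k
      · exact ⟨b, hb, fun hbk => hab (hak.trans hbk.symm)⟩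
      · exact ⟨a, ha, hak⟩
    refine hμ.exists_mem_Hstar (ν := ![x, k]) ?_ ?_ 0
    · intro i j hij
      fin_cases i <;> fin_cases j <;> simp_all
    · intro c
      fin_cases c
      · exact hx
      · exact hk
  · by_contra hc
    have hone : ∀ c, ∀ h, UnanAcc pref eval c h → c = 0 := by
      intro c h hh
      fin_cases c
      · rfl
      · exact absurd ⟨h, hh⟩ hacc
    have hmem : (0 : Fin 2) ∈ Istar pref eval ![some a, none] := ⟨a, rfl, ha⟩
    refine hμ.2.2 ![some a, none] ?_ ?_ (Or.inl ⟨⟨?_, fun hsub => hc (hsub hmem)⟩, ?_⟩)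
    · intro c c' h h₁ h₂
      fin_cases c <;> fin_cases c' <;> simp_all
    · intro c h hh
      fin_cases c
      · obtain rfl := Option.some.inj hh
        exact ha.1
      · cases hh
    · rintro c ⟨h, -, hh⟩
      exact hone c h hh.1 ▸ hmem
    · rintro c ⟨h, -, hh⟩
      have hacc : UnanAcc pref eval c h := hh.elim (fun h => h.1) (fun h => h.1)
      exact hone c h hacc ▸ ⟨a, rfl, Or.inl ha⟩

/-- The ranking induced by a score: `x` is above `y` if `x` has the higher score. -/
def scoreRel (r : Option H → ℕ) : OptRel H := fun x y => r y < r x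

theorem isStrictTotalOrder_scoreRel {r : Option H → ℕ} (hr : Function.Injective r) :
    IsStrictTotalOrder (Option H) (scoreRel r) where
  irrefl _ := lt_irrefl _
  trans _ _ _ h₁ h₂ := lt_trans h₂ h₁
  trichotomous _ _ h₁ h₂ := hr (le_antisymm (not_lt.1 h₁) (not_lt.1 h₂))

/-- `Hstar` in terms of scores. -/
theorem mem_Hstar_iff_of_scoreRel {pref eval : C → OptRel H} {c : C} {r s : Option H → ℕ}
    (hp : pref c = scoreRel r) (he : eval c = scoreRel s) (h : H) :
    h ∈ Hstar pref eval c ↔ (r none < r (some h) ∧ s none < s (some h)) ∧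
      ∀ h', ¬(r (some h) < r (some h') ∧ s (some h) < s (some h')) := by
  simp only [Hstar, UnanAcc, Improvers, hp, he, scoreRel, Set.mem_ofPred_eq,
    Set.eq_empty_iff_forall_notMem]

/-- The score giving `∅` the value `2` and home `i` the value `v i`. -/
def homeScore (v : Fin 4 → ℕ) : Option (Fin 4) → ℕ
  | none => 2
  | some h => v h

theorem homeScore_injective_iff (v : Fin 4 → ℕ) :
    Function.Injective (homeScore v) ↔ Function.Injective v ∧ ∀ h, v h ≠ 2 := by
  constructor
  · refine fun hv => ⟨fun i j hij => Option.some.inj (hv hij), fun h hh => ?_⟩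
    cases hv (a₁ := some h) (a₂ := none) hh
  · rintro ⟨hv, hn⟩ (_ | i) (_ | j) hij
    · rfl
    · exact absurd hij.symm (hn j)
    · exact absurd hij (hn i)
    · exact congrArg some (hv hij)

/-- On a finite set, every nonempty set of assignments has a worst element. -/
theorem exists_isWorst [Finite H] {p : OptRel H} (hp : IsStrictTotalOrder (Option H) p)
    {S : Set (Option H)} (hS : S.Nonempty) : ∃ x, IsWorst p S x := by
  have wf : WellFounded (Function.swap p) :=
    Finite.wellFounded_of_trans_of_irrefl _
  obtain ⟨m, hm, hmin⟩ := wf.has_min S hS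
  refine ⟨m, hm, fun y hy => ?_⟩
  rcases trichotomous_of p y m with h | h | h
  · exact Or.inr h
  · exact Or.inl h
  · exact absurd h (hmin y hy)

/-- If every element of `S'` is better than some element of `S`, then the worst element of `S'` is
better than the worst element of `S`. -/
theorem exists_isWorst_lt [Finite H] {p : OptRel H} (hp : IsStrictTotalOrder (Option H) p)
    {S S' : Set (Option H)} (hS' : S'.Nonempty) {x : Option H} (hx : x ∈ S)
    (h : ∀ y ∈ S', p y x) : ∃ w' w, IsWorst p S' w' ∧ IsWorst p S w ∧ p w' w := by
  obtain ⟨w', hw'⟩ := exists_isWorst hp hS'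
  obtain ⟨w, hw⟩ := exists_isWorst hp ⟨x, hx⟩
  refine ⟨w', w, hw', hw, ?_⟩
  rcases hw.2 x hx with rfl | hxw
  · exact h w' hw'.1
  · exact _root_.trans (h w' hw'.1) hxw

/-- Every report of strict rankings has a consistent assignment. -/
theorem consistentOut_nonempty
    (φ : (Fin 2 → OptRel (Fin 4)) → (Fin 2 → OptRel (Fin 4)) → Fin 2 → Option (Fin 4))
    (c : Fin 2) {p e : OptRel (Fin 4)} (hp : IsStrictTotalOrder (Option (Fin 4)) p)
    (he : IsStrictTotalOrder (Option (Fin 4)) e) : (ConsistentOut φ c p e).Nonempty :=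
  ⟨_, fun _ => p, fun _ => e, fun _ => hp, fun _ => he, rfl, rfl, rfl⟩

/-- **every unanimous mechanism is obviously manipulable.**
In a market with two children and four homes, every mechanism that always outputs a
unanimous matching admits a worst-case manipulation: some child with some true
preference–evaluation pair `(p, e)` has a report `p'` whose worst consistent assignment
is strictly `p`-better than the worst consistent assignment of truth-telling. -/
theorem unanimous_mechanism_obviously_manipulable :
    ∀ φ : (Fin 2 → OptRel (Fin 4)) → (Fin 2 → OptRel (Fin 4)) → Fin 2 → Option (Fin 4),
      (∀ pref eval : Fin 2 → OptRel (Fin 4),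
        (∀ c, IsStrictTotalOrder (Option (Fin 4)) (pref c)) →
        (∀ c, IsStrictTotalOrder (Option (Fin 4)) (eval c)) →
        Unanimous pref eval (φ pref eval)) →
      ∃ (c : Fin 2) (p e p' : OptRel (Fin 4)),
        IsStrictTotalOrder (Option (Fin 4)) p ∧
        IsStrictTotalOrder (Option (Fin 4)) e ∧
        IsStrictTotalOrder (Option (Fin 4)) p' ∧
        ∃ w' w : Option (Fin 4),
          IsWorst p (ConsistentOut φ c p' e) w' ∧
          IsWorst p (ConsistentOut φ c p e) w ∧ p w' w := by
  intro φ hφ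
  have strict (v : Fin 4 → ℕ) (hv : Function.Injective v ∧ ∀ h, v h ≠ 2) :
      IsStrictTotalOrder (Option (Fin 4)) (scoreRel (homeScore v)) :=
    isStrictTotalOrder_scoreRel ((homeScore_injective_iff v).2 hv)
  have he := strict ![3, 4, 5, 0] (by decide)
  have hp := strict ![5, 4, 3, 0] (by decide)
  have hq := strict ![4, 3, 1, 0] (by decide)
  have hr := strict ![4, 5, 3, 0] (by decide)
  have hs := strict ![1, 3, 0, 4] (by decide)
  have ht := strict ![1, 3, 4, 0] (by decide)
  by_cases hsub : ∀ x ∈ ConsistentOut φ 0 (scoreRel (homeScore ![5, 4, 3, 0]))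
      (scoreRel (homeScore ![3, 4, 5, 0])), x = some 0 ∨ x = some 1
  · -- If the other child accepts only home 1, then truthful `1 ≻ 0 ≻ 2` yields home 2.
    let pref : Fin 2 → OptRel (Fin 4) :=
      ![scoreRel (homeScore ![4, 5, 3, 0]), scoreRel (homeScore ![1, 3, 0, 4])]
    let eval : Fin 2 → OptRel (Fin 4) :=
      ![scoreRel (homeScore ![3, 4, 5, 0]), scoreRel (homeScore ![1, 3, 4, 0])]
    have hpref : ∀ c, IsStrictTotalOrder (Option (Fin 4)) (pref c) :=
      Fin.forall_fin_two.2 ⟨hr, hs⟩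
    have heval : ∀ c, IsStrictTotalOrder (Option (Fin 4)) (eval c) :=
      Fin.forall_fin_two.2 ⟨he, ht⟩
    have hμ := hφ pref eval hpref heval
    have hstar₀ := mem_Hstar_iff_of_scoreRel (pref := pref) (eval := eval) (c := 0) rfl rfl
    have hstar₁ := mem_Hstar_iff_of_scoreRel (pref := pref) (eval := eval) (c := 1) rfl rfl
    have hmem := hμ.exists_mem_Hstar (ν := ![2, 1]) (by decide)
      (Fin.forall_fin_two.2 ⟨(hstar₀ 2).2 (by decide), (hstar₁ 1).2 (by decide)⟩)
    obtain ⟨h₀, hh₀, hmem₀⟩ := hmem 0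
    obtain ⟨h₁, hh₁, hmem₁⟩ := hmem 1
    have eq₁ : h₁ = 1 := by
      rw [hstar₁] at hmem₁
      clear hh₁
      revert h₁
      decide
    have ne₁ : h₀ ≠ 1 := by
      rintro rfl
      exact absurd (hμ.1 0 1 1 hh₀ (eq₁ ▸ hh₁)) (by decide)
    have eq₀ : h₀ = 2 := by
      rw [hstar₀] at hmem₀
      clear hh₀
      revert h₀
      decide
    refine ⟨0, _, _, _, hr, he, hp, exists_isWorst_lt hr (consistentOut_nonempty φ 0 hp he)
      (x := some 2) ⟨pref, eval, hpref, heval, rfl, rfl, eq₀ ▸ hh₀⟩ fun y hy => ?_⟩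
    rcases hsub y hy with rfl | rfl <;> simp [scoreRel, homeScore]
  · -- Reporting home 2 as unacceptable guarantees home 0 or 1.
    push Not at hsub
    obtain ⟨x, hx, hx0, hx1⟩ := hsub
    refine ⟨0, _, _, _, hp, he, hq,
      exists_isWorst_lt hp (consistentOut_nonempty φ 0 hq he) hx ?_⟩
    rintro y ⟨pref, eval, hpref, heval, hpq, hee, rfl⟩
    have hstar := mem_Hstar_iff_of_scoreRel hpq hee
    obtain ⟨h, hh, hmem⟩ := (hφ pref eval hpref heval).mem_Hstar_of_two hpref heval
      (a := 0) (b := 1) (by decide) ((hstar 0).2 (by decide)) ((hstar 1).2 (by decide))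
    rw [hh]
    rw [hstar] at hmem
    have hh01 : h = 0 ∨ h = 1 := by
      clear hh
      revert h
      decide
    clear hx
    rcases hh01 with rfl | rfl <;> rcases x with _ | x <;> try fin_cases x
    all_goals simp_all [scoreRel, homeScore]

end
end

section
/- For every child c with strict preference ≻_c and strict evaluation >_c, the extended unanimity relation T^u_c is a strict total order on H ∪ {∅}: it is irreflexive, transitive, asymmetric, and any two distinct elements are comparable. -/
open scoped Classical

noncomputable section

variable {C H : Type*}

/-- `T^u_c` is the lexicographic order by unanimous level, then preference. -/
theorem tu_iff_urank {C H : Type*} (pref eval : C → OptRel H) (c : C)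
    (hirr : ¬ pref c none none) (x y : Option H) :
    Tu pref eval c x y ↔ urank pref eval c y < urank pref eval c x ∨
      (urank pref eval c x = urank pref eval c y ∧ pref c x y) := by
  have hacc (h : H) : UnanAcc pref eval c h ↔
      h ∈ Hstar pref eval c ∨ h ∈ Hminus pref eval c := by
    simp only [Hminus, Hstar, Set.mem_ofPred_eq]
    tauto
  have hdisj (h : H) : h ∈ Hminus pref eval c → h ∉ Hstar pref eval c := And.right
  rcases x with _ | x <;> rcases y with _ | y
  · simp [Tu, urank, hirr]
  · simp only [Tu, urank, hacc]
    split_ifs <;> simp_all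
  · simp only [Tu, urank, hacc]
    split_ifs <;> simp_all
  · have hx := hdisj x
    have hy := hdisj y
    simp only [Tu, urank, Set.mem_union]
    grind

/-- **the extended unanimity relation is a strict total order.**
For every child `c`, `T^u_c` is irreflexive, transitive, asymmetric, and any two
distinct elements of `H ∪ {∅}` are comparable. -/
theorem tu_isStrictTotalOrder {C H : Type*} (pref eval : C → OptRel H)
    (hpref : ∀ c, IsStrictTotalOrder (Option H) (pref c))
    (heval : ∀ c, IsStrictTotalOrder (Option H) (eval c)) (c : C) :
    (∀ x : Option H, ¬ Tu pref eval c x x) ∧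
    (∀ x y z : Option H, Tu pref eval c x y → Tu pref eval c y z → Tu pref eval c x z) ∧
    (∀ x y : Option H, Tu pref eval c x y → ¬ Tu pref eval c y x) ∧
    (∀ x y : Option H, x ≠ y → Tu pref eval c x y ∨ Tu pref eval c y x) := by
  have := hpref c
  have h_iff := tu_iff_urank pref eval c (irrefl_of (pref c) none)
  have h_irrefl (x : Option H) : ¬ Tu pref eval c x x := by
    simp [h_iff, irrefl_of (pref c) x]
  have h_trans (x y z : Option H) (hxy : Tu pref eval c x y) (hyz : Tu pref eval c y z) :
      Tu pref eval c x z := by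
    rw [h_iff] at *
    rcases hxy with hxy | ⟨hxy, pxy⟩ <;> rcases hyz with hyz | ⟨hyz, pyz⟩
    · exact .inl (hyz.trans hxy)
    · exact .inl (hyz ▸ hxy)
    · exact .inl (hxy ▸ hyz)
    · exact .inr ⟨hxy.trans hyz, trans_of (pref c) pxy pyz⟩
  refine ⟨h_irrefl, h_trans, fun x y hxy hyx => h_irrefl x (h_trans x y x hxy hyx), ?_⟩
  intro x y hne
  rw [h_iff, h_iff]
  rcases lt_trichotomy (urank pref eval c x) (urank pref eval c y) with h | h | h
  · exact .inr (.inl h)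
  · rcases trichotomous_of (pref c) x y with p | p | p
    · exact .inl (.inr ⟨h, p⟩)
    · exact absurd p hne
    · exact .inr (.inr ⟨h.symm, p⟩)
  · exact .inl (.inl h)

end
end

section
/- The extended unanimity rule τ^u satisfies the weak Pareto principle: for all homes h, h', if h ≻_c h' and h >_c h' then h T^u_c h'; if ∅ ≻_c h and ∅ >_c h then ∅ T^u_c h; and if h ≻_c ∅ and h >_c ∅ then h T^u_c ∅. -/
open scoped Classical

noncomputable section

variable {C H : Type*}

/-- A home with a unanimous improver does not belong to `H*(c)`. -/
theorem notMem_hstar_of_mem_improvers {pref eval : C → OptRel H} {c : C} {h h' : H}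
    (hI : h ∈ Improvers pref eval c (some h')) : h' ∉ Hstar pref eval c :=
  fun hs => Set.notMem_empty h (hs.2 ▸ hI)

/-- A unanimous improver over a unanimously acceptable home is unanimously acceptable. -/
theorem UnanAcc.of_mem_improvers {pref eval : C → OptRel H} {c : C} {h h' : H}
    [IsTrans (Option H) (pref c)] [IsTrans (Option H) (eval c)]
    (ha : UnanAcc pref eval c h') (hI : h ∈ Improvers pref eval c (some h')) :
    UnanAcc pref eval c h :=
  ⟨_root_.trans hI.1 ha.1, _root_.trans hI.2 ha.2⟩

/-- **the extended unanimity rule satisfies the weak Pareto principle.** -/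
theorem tu_weak_pareto_principle {C H : Type*} (pref eval : C → OptRel H)
    (hpref : ∀ c, IsStrictTotalOrder (Option H) (pref c))
    (heval : ∀ c, IsStrictTotalOrder (Option H) (eval c)) (c : C) :
    (∀ h h' : H, pref c (some h) (some h') → eval c (some h) (some h') →
      Tu pref eval c (some h) (some h')) ∧
    (∀ h : H, pref c none (some h) → eval c none (some h) →
      Tu pref eval c none (some h)) ∧
    (∀ h : H, pref c (some h) none → eval c (some h) none →
      Tu pref eval c (some h) none) := by
  have := hpref c
  have := heval c
  refine ⟨fun h h' hp he => ?_, fun h hp _ ha => asymm hp ha.1, fun h hp he => ⟨hp, he⟩⟩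
  have hI : h ∈ Improvers pref eval c (some h') := ⟨hp, he⟩
  have hs : h' ∉ Hstar pref eval c := notMem_hstar_of_mem_improvers hI
  by_cases hstar : h ∈ Hstar pref eval c
  · exact Or.inl ⟨hstar, hs⟩
  by_cases hminus' : h' ∈ Hminus pref eval c
  · exact Or.inr (Or.inr ⟨Or.inr (Or.inl ⟨⟨hminus'.1.of_mem_improvers hI, hstar⟩, hminus'⟩), hp⟩)
  have hun' : h' ∉ Hstar pref eval c ∪ Hminus pref eval c := not_or.2 ⟨hs, hminus'⟩
  by_cases hminus : h ∈ Hminus pref eval c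
  · exact Or.inr (Or.inl ⟨hminus, hun'⟩)
  · exact Or.inr (Or.inr ⟨Or.inr (Or.inr ⟨not_or.2 ⟨hstar, hminus⟩, hun'⟩), hp⟩)

end
end
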